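/- Let 𝒢 be a finite set of groups and Ŝ a groupwise calibrated soft classifier over 𝒢 with a nice accuracy profile 𝒫 such that |Supp(𝒫_g)| ≥ 2 for all g ∈ 𝒢, and let s_min be the minimum score in the common support. Then for every value w with s_min < w < min_{g∈𝒢} BR_g, there exists a non-trivial threshold post-processor D̂_{(τ,R)} (not necessarily group blind) such that the composed hard classifier Ŷ = D̂_{(τ,R)}∘Ŝ satisfies NPV_{Ŷ,g} = 1 − w for every group g ∈ 𝒢; in particular Ŷ equalizes NPV across 𝒢, and the common NPV can be made equal to any value in (1 − min_{g∈𝒢} BR_g, 1 − s_min). -/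

import Mathlib

open Finset
open scoped Classical

namespace GroupFairness

noncomputable section

variable {X 𝒢 Ω : Type*} [Fintype X] [Fintype Ω]

/-- The finset of members of group `g`. -/
def grp (Grp : X → 𝒢) (g : 𝒢) : Finset X :=
  Finset.univ.filter (fun x => Grp x = g)

/-- Expectation of `f x ω` over a uniformly random member `x` of group `g`,
together with internal randomness `ω` distributed according to the weights `w`. -/
def Ex (w : Ω → ℝ) (Grp : X → 𝒢) (g : 𝒢) (f : X → Ω → ℝ) : ℝ :=
  (∑ x ∈ grp Grp g, ∑ ω : Ω, w ω * f x ω) / ((grp Grp g).card : ℝ)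

/-- Probability of the event `E x ω` for a uniformly random member of group `g`. -/
def Pr (w : Ω → ℝ) (Grp : X → 𝒢) (g : 𝒢) (E : X → Ω → Prop) : ℝ :=
  Ex w Grp g (fun x ω => if E x ω then 1 else 0)

/-- Conditional probability of `E` given `F`. -/
def cPr (w : Ω → ℝ) (Grp : X → 𝒢) (g : 𝒢) (E F : X → Ω → Prop) : ℝ :=
  Pr w Grp g (fun x ω => E x ω ∧ F x ω) / Pr w Grp g F

/-- `w` is a probability weighting on the randomness space. -/
def ValidWeights (w : Ω → ℝ) : Prop :=
  (∀ ω, 0 ≤ w ω) ∧ ∑ ω : Ω, w ω = 1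

/-- The base rate of group `g`: the probability that a uniformly random member
of `g` has true type `1`. -/
def BaseRate (w : Ω → ℝ) (Grp : X → 𝒢) (Y : X → Bool) (g : 𝒢) : ℝ :=
  Pr w Grp g (fun x _ => Y x = true)

/-- All scores of the soft classifier lie in `[0,1]`. -/
def IsSoft (S : X → Ω → ℝ) : Prop :=
  ∀ x ω, 0 ≤ S x ω ∧ S x ω ≤ 1

/-- `S` is groupwise calibrated: for every group `g` and score `s` occurring with
positive probability, `Pr[Y = 1 ∣ S = s] = s`. -/
def Calibrated (w : Ω → ℝ) (Grp : X → 𝒢) (Y : X → Bool) (S : X → Ω → ℝ) : Prop :=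
  ∀ (g : 𝒢) (s : ℝ), 0 < Pr w Grp g (fun x ω => S x ω = s) →
    cPr w Grp g (fun x _ => Y x = true) (fun x ω => S x ω = s) = s

/-- The accuracy profile of `S` on group `g`: the pmf of the score `S(X_g)`. -/
def AP (w : Ω → ℝ) (Grp : X → 𝒢) (S : X → Ω → ℝ) (g : 𝒢) (s : ℝ) : ℝ :=
  Pr w Grp g (fun x ω => S x ω = s)

/-- The support of the accuracy profile of `S` on group `g`. -/
def APsupp (w : Ω → ℝ) (Grp : X → 𝒢) (S : X → Ω → ℝ) (g : 𝒢) : Set ℝ :=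
  {s | 0 < AP w Grp S g s}

/-- The accuracy profile is *nice*: all groups have the same support. -/
def NiceAP (w : Ω → ℝ) (Grp : X → 𝒢) (S : X → Ω → ℝ) : Prop :=
  ∀ g g' : 𝒢, APsupp w Grp S g = APsupp w Grp S g'

/-- A (randomized) hard post-processor is described by the probability `q s g` of
outputting `1` on score `s` and group `g`; it is valid if these are probabilities. -/
def ValidPP (q : ℝ → 𝒢 → ℝ) : Prop :=
  ∀ (s : ℝ) (g : 𝒢), 0 ≤ q s g ∧ q s g ≤ 1

/-- Probability that the composed hard classifier `D̂ ∘ Ŝ` outputs `1` on group `g`. -/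
def prPos (w : Ω → ℝ) (Grp : X → 𝒢) (S : X → Ω → ℝ) (q : ℝ → 𝒢 → ℝ) (g : 𝒢) : ℝ :=
  Ex w Grp g (fun x ω => q (S x ω) (Grp x))

/-- Probability that the composed hard classifier `D̂ ∘ Ŝ` outputs `0` on group `g`. -/
def prNeg (w : Ω → ℝ) (Grp : X → 𝒢) (S : X → Ω → ℝ) (q : ℝ → 𝒢 → ℝ) (g : 𝒢) : ℝ :=
  Ex w Grp g (fun x ω => 1 - q (S x ω) (Grp x))

/-- The composed hard classifier is non-trivial on `g`. -/
def NonTrivial (w : Ω → ℝ) (Grp : X → 𝒢) (S : X → Ω → ℝ) (q : ℝ → 𝒢 → ℝ) (g : 𝒢) : Prop :=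
  0 < prPos w Grp S q g ∧ 0 < prNeg w Grp S q g

/-- Positive predictive value `Pr[Y = 1 ∣ Ŷ = 1]` of the composed classifier on `g`. -/
def PPV (w : Ω → ℝ) (Grp : X → 𝒢) (Y : X → Bool) (S : X → Ω → ℝ)
    (q : ℝ → 𝒢 → ℝ) (g : 𝒢) : ℝ :=
  Ex w Grp g (fun x ω => (if Y x then 1 else 0) * q (S x ω) (Grp x)) / prPos w Grp S q g

/-- Negative predictive value `Pr[Y = 0 ∣ Ŷ = 0]` of the composed classifier on `g`. -/
def NPV (w : Ω → ℝ) (Grp : X → 𝒢) (Y : X → Bool) (S : X → Ω → ℝ)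
    (q : ℝ → 𝒢 → ℝ) (g : 𝒢) : ℝ :=
  Ex w Grp g (fun x ω => (if Y x then 0 else 1) * (1 - q (S x ω) (Grp x))) / prNeg w Grp S q g

/-- False positive rate `Pr[Ŷ = 1 ∣ Y = 0]` of the composed classifier on `g`. -/
def FPR (w : Ω → ℝ) (Grp : X → 𝒢) (Y : X → Bool) (S : X → Ω → ℝ)
    (q : ℝ → 𝒢 → ℝ) (g : 𝒢) : ℝ :=
  Ex w Grp g (fun x ω => (if Y x then 0 else 1) * q (S x ω) (Grp x)) /
    Pr w Grp g (fun x _ => Y x = false)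

/-- False negative rate `Pr[Ŷ = 0 ∣ Y = 1]` of the composed classifier on `g`. -/
def FNR (w : Ω → ℝ) (Grp : X → 𝒢) (Y : X → Bool) (S : X → Ω → ℝ)
    (q : ℝ → 𝒢 → ℝ) (g : 𝒢) : ℝ :=
  Ex w Grp g (fun x ω => (if Y x then 1 else 0) * (1 - q (S x ω) (Grp x))) /
    Pr w Grp g (fun x _ => Y x = true)

/-- The threshold post-processor with threshold `τ g` and on-threshold probability
`R g` for group `g`: it outputs `1` with probability `1` above the threshold, `0`
below it, and `1` with probability `R g` at the threshold. -/
def thresholdPP (τ R : 𝒢 → ℝ) : ℝ → 𝒢 → ℝ := fun s g =>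
  if τ g < s then 1 else if s = τ g then R g else 0

/-- If a signed weight has negative mass below `t₀` and positive total mass, then some randomized
threshold strictly above `t₀` selects mass exactly zero. -/
theorem exists_threshold_sum_eq_zero {ι : Type*} (I : Finset ι) (a s : ι → ℝ) (t₀ : ℝ)
    (hneg : ∑ i ∈ I, a i * (if s i ≤ t₀ then 1 else 0) < 0) (hpos : 0 < ∑ i ∈ I, a i) :
    ∃ τ R : ℝ, t₀ < τ ∧ 0 ≤ R ∧ R ≤ 1 ∧
      ∑ i ∈ I, a i * (1 - if τ < s i then 1 else if s i = τ then R else 0) = 0 := by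
  set F : ℝ → ℝ := fun t => ∑ i ∈ I, a i * (if s i ≤ t then 1 else 0) with hF
  set T : Finset ℝ := (insert t₀ (I.image s)).filter (fun t => t₀ ≤ t) with hT
  have hmem : ∀ i ∈ I, t₀ ≤ s i → s i ∈ T := fun i hi h => by
    simp only [hT, mem_filter, mem_insert, mem_image]
    exact ⟨Or.inr ⟨i, hi, rfl⟩, h⟩
  have ht₀ : t₀ ∈ T := by simp [hT]
  obtain ⟨M, hM, hMmax⟩ := T.exists_max_image id ⟨t₀, ht₀⟩
  have hFM : 0 ≤ F M := by
    have : F M = ∑ i ∈ I, a i := sum_congr rfl fun i hi => by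
      have : s i ≤ M := by
        rcases le_total t₀ (s i) with h | h
        · exact hMmax _ (hmem i hi h)
        · exact h.trans (hMmax _ ht₀)
      simp [this]
    rw [this]; exact hpos.le
  obtain ⟨τ, hτ, hτmin⟩ := (T.filter (fun t => 0 ≤ F t)).exists_min_image id
    ⟨M, mem_filter.2 ⟨hM, hFM⟩⟩
  obtain ⟨hτT, hFτ⟩ := mem_filter.1 hτ
  have hτt₀ : t₀ < τ := by
    refine lt_of_le_of_ne (mem_filter.1 hτT).2 fun h => ?_
    subst h
    exact absurd hneg (not_lt.2 hFτ)
  obtain ⟨p, hp, hpmax⟩ := (T.filter (fun t => t < τ)).exists_max_image id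
    ⟨t₀, mem_filter.2 ⟨ht₀, hτt₀⟩⟩
  obtain ⟨hpT, hpτ⟩ := mem_filter.1 hp
  have hFp : F p < 0 := by
    by_contra! h
    exact absurd hpτ (not_lt.2 (hτmin p (mem_filter.2 ⟨hpT, h⟩)))
  have hsp : ∀ i ∈ I, s i < τ → s i ≤ p := fun i hi h => by
    rcases le_total t₀ (s i) with h' | h'
    · exact hpmax _ (mem_filter.2 ⟨hmem i hi h', h⟩)
    · exact h'.trans (hpmax _ (mem_filter.2 ⟨ht₀, hτt₀⟩))
  have hd : 0 < F τ - F p := by linarith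
  refine ⟨τ, F τ / (F τ - F p), hτt₀, by positivity, (div_le_one hd).2 (by linarith), ?_⟩
  set R := F τ / (F τ - F p) with hR
  have hsum : ∑ i ∈ I, a i * (1 - if τ < s i then 1 else if s i = τ then R else 0)
      = (1 - R) * F τ + R * F p := by
    rw [hF, mul_sum, mul_sum, ← sum_add_distrib]
    refine sum_congr rfl fun i hi => ?_
    rcases lt_trichotomy (s i) τ with h | h | h
    · simp [h.not_gt, h.ne, h.le, hsp i hi h]; ring
    · simp [h, not_le.2 hpτ]; ring
    · simp [h, not_le.2 h, not_le.2 (hpτ.trans h)]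
  rw [hsum, hR]
  field_simp
  ring

theorem Ex_eq_sum_product (w : Ω → ℝ) (Grp : X → 𝒢) (g : 𝒢) (f : X → Ω → ℝ) :
    Ex w Grp g f = (∑ i ∈ grp Grp g ×ˢ univ, w i.2 * f i.1 i.2) / ((grp Grp g).card : ℝ) := by
  rw [Ex, sum_product]

theorem Ex_congr {w : Ω → ℝ} {Grp : X → 𝒢} {g : 𝒢} {f f' : X → Ω → ℝ}
    (h : ∀ x, Grp x = g → ∀ ω, w ω * f x ω = w ω * f' x ω) : Ex w Grp g f = Ex w Grp g f' := by
  unfold Ex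
  congr 1
  exact sum_congr rfl fun x hx => sum_congr rfl fun ω _ => h x (by simpa [grp] using hx) ω

theorem Ex_sub (w : Ω → ℝ) (Grp : X → 𝒢) (g : 𝒢) (f f' : X → Ω → ℝ) :
    Ex w Grp g (fun x ω => f x ω - f' x ω) = Ex w Grp g f - Ex w Grp g f' := by
  simp only [Ex_eq_sum_product, mul_sub, sum_sub_distrib, sub_div]

theorem Ex_const_mul (w : Ω → ℝ) (Grp : X → 𝒢) (g : 𝒢) (c : ℝ) (f : X → Ω → ℝ) :
    Ex w Grp g (fun x ω => c * f x ω) = c * Ex w Grp g f := by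
  simp only [Ex_eq_sum_product, mul_left_comm _ c, ← mul_sum, mul_div_assoc]

theorem Ex_mono {w : Ω → ℝ} (hw : ValidWeights w) {Grp : X → 𝒢} {g : 𝒢} {f f' : X → Ω → ℝ}
    (h : ∀ x, Grp x = g → ∀ ω, f x ω ≤ f' x ω) : Ex w Grp g f ≤ Ex w Grp g f' := by
  unfold Ex
  refine div_le_div_of_nonneg_right ?_ (Nat.cast_nonneg _)
  exact sum_le_sum fun x hx => sum_le_sum fun ω _ =>
    mul_le_mul_of_nonneg_left (h x (by simpa [grp] using hx) ω) (hw.1 ω)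

theorem Ex_one {w : Ω → ℝ} (hw : ValidWeights w) {Grp : X → 𝒢} {g : 𝒢}
    (hne : (grp Grp g).Nonempty) : Ex w Grp g (fun _ _ => 1) = 1 := by
  have : ((grp Grp g).card : ℝ) ≠ 0 := by exact_mod_cast hne.card_pos.ne'
  simp [Ex, hw.2, this]

theorem BaseRate_eq_Ex (w : Ω → ℝ) (Grp : X → 𝒢) (Y : X → Bool) (g : 𝒢) :
    BaseRate w Grp Y g = Ex w Grp g (fun x _ => if Y x then 1 else 0) :=
  Ex_congr fun x _ _ => by cases h : Y x <;> simp [h]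

theorem mem_APsupp_of_pos {w : Ω → ℝ} (hw : ValidWeights w) {Grp : X → 𝒢} (S : X → Ω → ℝ)
    {x : X} {ω : Ω} (hω : 0 < w ω) : S x ω ∈ APsupp w Grp S (Grp x) := by
  have hx : x ∈ grp Grp (Grp x) := by simp [grp]
  have hi : (x, ω) ∈ grp Grp (Grp x) ×ˢ (univ : Finset Ω) := by simp [hx]
  simp only [APsupp, Set.mem_ofPred_eq, AP, Pr, Ex_eq_sum_product]
  refine div_pos (sum_pos' (fun i _ => ?_) ⟨(x, ω), hi, by simpa using hω⟩)
    (Nat.cast_pos.2 (card_pos.2 ⟨x, hx⟩))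
  exact mul_nonneg (hw.1 _) (by split_ifs <;> norm_num)

/-- The single-group version: for a calibrated score and `v` strictly between the minimum score and
the base rate, some randomized threshold above the minimum score makes the true types in the
negatively classified part average to `v`. -/
theorem exists_threshold_Ex_eq_zero {w : Ω → ℝ} {Grp : X → 𝒢} {Y : X → Bool} {S : X → Ω → ℝ}
    {smin v : ℝ} (hw : ValidWeights w) {g : 𝒢} (hne : (grp Grp g).Nonempty)
    (hcal : Calibrated w Grp Y S)
    (hsmin : smin ∈ APsupp w Grp S g ∧ ∀ s ∈ APsupp w Grp S g, smin ≤ s)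
    (hv₁ : smin < v) (hv₂ : v < BaseRate w Grp Y g) :
    ∃ τ R : ℝ, smin < τ ∧ 0 ≤ R ∧ R ≤ 1 ∧
      Ex w Grp g (fun x ω => ((if Y x then 1 else 0) - v) *
        (1 - if τ < S x ω then 1 else if S x ω = τ then R else 0)) = 0 := by
  have hcard : (0 : ℝ) < (grp Grp g).card := Nat.cast_pos.2 hne.card_pos
  have hP : 0 < Pr w Grp g (fun x ω => S x ω = smin) := hsmin.1
  have hYP := (div_eq_iff hP.ne').1 (hcal g smin hP)
  have hneg : Ex w Grp g (fun x ω => ((if Y x then 1 else 0) - v) *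
      (if S x ω ≤ smin then 1 else 0)) < 0 := by
    have : Ex w Grp g (fun x ω => ((if Y x then 1 else 0) - v) * (if S x ω ≤ smin then 1 else 0))
        = Pr w Grp g (fun x ω => Y x = true ∧ S x ω = smin)
          - v * Pr w Grp g (fun x ω => S x ω = smin) := by
      unfold Pr
      rw [← Ex_const_mul, ← Ex_sub]
      refine Ex_congr fun x hx ω => ?_
      rcases (hw.1 ω).eq_or_lt with h | h
      · simp [← h]
      · have hle : smin ≤ S x ω := hsmin.2 _ (hx ▸ mem_APsupp_of_pos hw S h)
        have hiff : S x ω ≤ smin ↔ S x ω = smin := ⟨fun h => le_antisymm h hle, fun h => h.le⟩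
        simp only [hiff]
        by_cases hs : S x ω = smin <;> simp [hs]
    rw [this, hYP]
    nlinarith
  have hpos : 0 < Ex w Grp g (fun x _ => (if Y x then 1 else 0) - v * 1) := by
    rw [Ex_sub, Ex_const_mul, Ex_one hw hne]
    rw [BaseRate_eq_Ex] at hv₂
    linarith
  rw [Ex_eq_sum_product, div_lt_iff₀ hcard, zero_mul] at hneg
  rw [Ex_eq_sum_product, div_pos_iff_of_pos_right hcard] at hpos
  obtain ⟨τ, R, h₁, h₂, h₃, h₄⟩ := exists_threshold_sum_eq_zero (grp Grp g ×ˢ univ)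
    (fun i : X × Ω => w i.2 * ((if Y i.1 then 1 else 0) - v)) (fun i => S i.1 i.2) smin
    (by simpa only [mul_assoc] using hneg) (by simpa only [mul_one] using hpos)
  refine ⟨τ, R, h₁, h₂, h₃, ?_⟩
  rw [Ex_eq_sum_product]
  simp only [mul_assoc] at h₄
  rw [h₄, zero_div]

/-- For a nice, groupwise calibrated soft classifier whose common
support has at least two points, and any value `v` strictly between the minimum score
of the common support and the minimum base rate, there is a (not necessarily
group-blind) non-trivial threshold post-processor making the NPV of every group equal
to `1 − v`; in particular NPV is equalized across the groups and can be made equal to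
any value in `(1 − min_g BR_g, 1 − s_min)`. -/
theorem exists_groupAware_threshold_equalizing_NPV [Fintype 𝒢]
    (w : Ω → ℝ) (Grp : X → 𝒢) (Y : X → Bool) (S : X → Ω → ℝ) (smin v : ℝ)
    (hw : ValidWeights w) (hne : ∀ g : 𝒢, (grp Grp g).Nonempty)
    (hS : IsSoft S) (hcal : Calibrated w Grp Y S) (hnice : NiceAP w Grp S)
    (hsupp2 : ∀ g : 𝒢, ∃ s₁ s₂ : ℝ, s₁ ≠ s₂ ∧
      s₁ ∈ APsupp w Grp S g ∧ s₂ ∈ APsupp w Grp S g)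
    (hsmin : ∀ g : 𝒢, smin ∈ APsupp w Grp S g ∧ ∀ s ∈ APsupp w Grp S g, smin ≤ s)
    (hv₁ : smin < v) (hv₂ : ∀ g : 𝒢, v < BaseRate w Grp Y g) :
    ∃ τ R : 𝒢 → ℝ, (∀ g : 𝒢, 0 ≤ R g ∧ R g ≤ 1) ∧
      (∀ g : 𝒢, NonTrivial w Grp S (thresholdPP τ R) g) ∧
      ∀ g : 𝒢, NPV w Grp Y S (thresholdPP τ R) g = 1 - v := by
  choose τ R hτ hR₀ hR₁ hzero using fun g =>
    exists_threshold_Ex_eq_zero hw (hne g) hcal (hsmin g) hv₁ (hv₂ g)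
  have hq : ∀ s g, 0 ≤ thresholdPP τ R s g ∧ thresholdPP τ R s g ≤ 1 := fun s g => by
    unfold thresholdPP
    split_ifs
    · norm_num
    · exact ⟨hR₀ g, hR₁ g⟩
    · norm_num
  have hbal : ∀ g, Ex w Grp g (fun x ω => ((if Y x then 1 else 0) - v) *
      (1 - thresholdPP τ R (S x ω) (Grp x))) = 0 := fun g => by
    refine Eq.trans ?_ (hzero g)
    refine Ex_congr fun x hx ω => ?_
    subst hx
    rfl
  have hprNeg : ∀ g, 0 < prNeg w Grp S (thresholdPP τ R) g := fun g => by
    refine lt_of_lt_of_le (hsmin g).1 (Ex_mono hw fun x hx ω => ?_)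
    split_ifs with h
    · have : S x ω < τ (Grp x) := by rw [h]; exact hτ _
      simp [thresholdPP, this.not_gt, this.ne]
    · linarith [(hq (S x ω) (Grp x)).2]
  have hprPos : ∀ g, 0 < prPos w Grp S (thresholdPP τ R) g := fun g => by
    have hb := hbal g
    have hle : Ex w Grp g (fun x ω => ((if Y x then 1 else 0) - v * 1) -
        (1 + |v|) * thresholdPP τ R (S x ω) (Grp x)) ≤
        Ex w Grp g (fun x ω => ((if Y x then 1 else 0) - v) *
          (1 - thresholdPP τ R (S x ω) (Grp x))) := Ex_mono hw fun x _ ω => by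
      have h := (hq (S x ω) (Grp x)).1
      have : (if Y x then (1 : ℝ) else 0) - v ≤ 1 + |v| := by
        split_ifs <;> linarith [neg_abs_le v]
      nlinarith
    rw [hb, Ex_sub, Ex_sub, Ex_const_mul, Ex_const_mul, Ex_one hw (hne g)] at hle
    have hv := hv₂ g
    rw [BaseRate_eq_Ex] at hv
    have : 0 < (1 + |v|) * prPos w Grp S (thresholdPP τ R) g := by
      unfold prPos
      linarith
    exact pos_of_mul_pos_right this (by positivity)
  refine ⟨τ, R, fun g => ⟨hR₀ g, hR₁ g⟩, fun g => ⟨hprPos g, hprNeg g⟩, fun g => ?_⟩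
  rw [NPV, div_eq_iff (hprNeg g).ne', ← sub_eq_zero, prNeg, ← Ex_const_mul, ← Ex_sub,
    ← neg_eq_zero, ← neg_one_mul, ← Ex_const_mul]
  refine Eq.trans ?_ (hbal g)
  refine Ex_congr fun x _ ω => ?_
  split_ifs <;> ring

end

end GroupFairness
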